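/- For every positive integer n, the pair (exc, den) is Euler-Mahonian over S_n; that is, for all nonnegative integers k and m, the number of permutations π in S_n with des(π) = k and maj(π) = m equals the number of permutations π in S_n with exc(π) = k and den(π) = m. Equivalently, ∑_{π∈S_n} t^{des(π)} q^{maj(π)} = ∑_{π∈S_n} t^{exc(π)} q^{den(π)}. -/

import Mathlib

open Finset

/-- The value of the permutation `π ∈ S_n` at the (1-based) position `i`,
in one-line notation with letters `1,…,n`; `0` if `i` is out of range. -/
def pval {n : ℕ} (π : Equiv.Perm (Fin n)) (i : ℕ) : ℕ :=
  if h : 1 ≤ i ∧ i ≤ n then ((π ⟨i - 1, by omega⟩ : Fin n) : ℕ) + 1 else 0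

/-- The number of inversions of a word `w`, i.e. pairs of positions `i < j`
with `w_i > w_j`. -/
def winv (w : List ℕ) : ℕ :=
  ((Finset.range w.length ×ˢ Finset.range w.length).filter
    (fun p => p.1 < p.2 ∧ w.getD p.2 0 < w.getD p.1 0)).card

/-- `rDes(π) = {i ∈ [n-1] : π_i ≥ π_{i+1} + r}`. -/
def rDesSet {n : ℕ} (r : ℕ) (π : Equiv.Perm (Fin n)) : Finset ℕ :=
  (Finset.Icc 1 (n - 1)).filter (fun i => pval π (i + 1) + r ≤ pval π i)

/-- The `r`-descent number `rdes(π)`. -/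
def rdes {n : ℕ} (r : ℕ) (π : Equiv.Perm (Fin n)) : ℕ := (rDesSet r π).card

/-- `rInv(π) = {(i,j) : i < j, π_i > π_j, π_i < π_j + r}`. -/
def rInvSet {n : ℕ} (r : ℕ) (π : Equiv.Perm (Fin n)) : Finset (ℕ × ℕ) :=
  ((Finset.Icc 1 n) ×ˢ (Finset.Icc 1 n)).filter
    (fun p => p.1 < p.2 ∧ pval π p.2 < pval π p.1 ∧ pval π p.1 < pval π p.2 + r)

/-- The `r`-major index `rmaj(π) = ∑_{i ∈ rDes(π)} i + |rInv(π)|`. -/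
def rmaj {n : ℕ} (r : ℕ) (π : Equiv.Perm (Fin n)) : ℕ :=
  (∑ i ∈ rDesSet r π, i) + (rInvSet r π).card

/-- The inversion number `inv(π)`: the number of pairs `i < j` with `π_i > π_j`. -/
def invStat {n : ℕ} (π : Equiv.Perm (Fin n)) : ℕ :=
  (((Finset.Icc 1 n) ×ˢ (Finset.Icc 1 n)).filter
    (fun p => p.1 < p.2 ∧ pval π p.2 < pval π p.1)).card

/-- `Excp_r(π)`: the set of `r`-level excedance places, i.e. indices `i`
with `π_i > i` and `π_i ≥ r`. -/
def excpSet {n : ℕ} (r : ℕ) (π : Equiv.Perm (Fin n)) : Finset ℕ :=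
  (Finset.Icc 1 n).filter (fun i => i < pval π i ∧ r ≤ pval π i)

/-- `Exc_r(π)`: the subword of `π` on the `r`-level excedance places,
in increasing order of position. -/
def excWord {n : ℕ} (r : ℕ) (π : Equiv.Perm (Fin n)) : List ℕ :=
  ((excpSet r π).sort (· ≤ ·)).map (pval π)

/-- `Nexc_r(π)`: the subword of `π` on the non-`r`-level-excedance places,
in increasing order of position. -/
def nexcWord {n : ℕ} (r : ℕ) (π : Equiv.Perm (Fin n)) : List ℕ :=
  (((Finset.Icc 1 n) \ excpSet r π).sort (· ≤ ·)).map (pval π)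

/-- The `r`-level Denert statistic
`den_r(π) = ∑_{i ∈ Excp_r(π)} i + inv(Exc_r(π)) + inv(Nexc_r(π))`. -/
def denr {n : ℕ} (r : ℕ) (π : Equiv.Perm (Fin n)) : ℕ :=
  (∑ i ∈ excpSet r π, i) + winv (excWord r π) + winv (nexcWord r π)

/-- The `r`-level excedance number `exc_r(π) = |{i : π_i > i ≥ r}|`. -/
def excr {n : ℕ} (r : ℕ) (π : Equiv.Perm (Fin n)) : ℕ :=
  ((Finset.Icc 1 n).filter (fun i => r ≤ i ∧ i < pval π i)).card

/-- `Des(π) = {i ∈ [n-1] : π_i > π_{i+1}}`. -/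
def desSet {n : ℕ} (π : Equiv.Perm (Fin n)) : Finset ℕ :=
  (Finset.Icc 1 (n - 1)).filter (fun i => pval π (i + 1) < pval π i)

/-- The descent number `des(π)`. -/
def desStat {n : ℕ} (π : Equiv.Perm (Fin n)) : ℕ := (desSet π).card

/-- The major index `maj(π) = ∑_{i ∈ Des(π)} i`. -/
def majStat {n : ℕ} (π : Equiv.Perm (Fin n)) : ℕ := ∑ i ∈ desSet π, i

/-- The set of excedance places of `π`: indices `i` with `π_i > i`. -/
def excpSet' {n : ℕ} (π : Equiv.Perm (Fin n)) : Finset ℕ :=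
  (Finset.Icc 1 n).filter (fun i => i < pval π i)

/-- The excedance number `exc(π)`. -/
def excStat {n : ℕ} (π : Equiv.Perm (Fin n)) : ℕ := (excpSet' π).card

/-- `Exc(π)`: the subword of `π` on the excedance places. -/
def excWord' {n : ℕ} (π : Equiv.Perm (Fin n)) : List ℕ :=
  ((excpSet' π).sort (· ≤ ·)).map (pval π)

/-- `Nexc(π)`: the subword of `π` on the non-excedance places. -/
def nexcWord' {n : ℕ} (π : Equiv.Perm (Fin n)) : List ℕ :=
  (((Finset.Icc 1 n) \ excpSet' π).sort (· ≤ ·)).map (pval π)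

/-- Denert's statistic `den(π) = ∑_{i excedance place} i + inv(Exc(π)) + inv(Nexc(π))`. -/
def denStat {n : ℕ} (π : Equiv.Perm (Fin n)) : ℕ :=
  (∑ i ∈ excpSet' π, i) + winv (excWord' π) + winv (nexcWord' π)

section GeneratingFunctions

open Polynomial

variable {R : Type*} [CommRing R]

/-- The product `∏_{a=1}^{d} (1 + q^a X) ∏_{a=d+1}^{d+e} (1 + t q^a X)`. -/
noncomputable def desPoly (t q : R) (d e : ℕ) : R[X] :=
  (∏ i ∈ range d, (1 + C (q ^ (i + 1)) * X)) *
    ∏ i ∈ range e, (1 + C (t * q ^ (d + 1 + i)) * X)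

/-- The relation between consecutive generating polynomials that both pairs of statistics
satisfy. -/
def StepRel (t q : R) (N : ℕ) (f g : R[X]) : Prop :=
  C (1 - q) * X * g =
    (1 + X) * (1 + C (t * q ^ N) * X) * f -
      (1 + C q * X) * (1 + C (t * q ^ N) * X) * f.comp (C q * X)

theorem StepRel.sum {ι : Type*} {t q : R} {N : ℕ} (s : Finset ι) (c : ι → R) {f g : ι → R[X]}
    (h : ∀ i ∈ s, StepRel t q N (f i) (g i)) :
    StepRel t q N (∑ i ∈ s, C (c i) * f i) (∑ i ∈ s, C (c i) * g i) := by
  unfold StepRel at *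
  rw [show (∑ i ∈ s, C (c i) * f i).comp (C q * X) = ∑ i ∈ s, (C (c i) * f i).comp (C q * X) from
    map_sum (compRingHom (C q * X)) _ _, mul_sum, mul_sum, mul_sum, ← sum_sub_distrib]
  refine sum_congr rfl fun i hi => ?_
  rw [mul_comp, C_comp]
  linear_combination C (c i) * h i hi

theorem StepRel.unique [IsDomain R] {t q : R} (hq : q ≠ 1) {N : ℕ} {f g g' : R[X]}
    (h : StepRel t q N f g) (h' : StepRel t q N f g') : g = g' := by
  have h0 : C (1 - q) * (X : R[X]) ≠ 0 :=
    mul_ne_zero (C_ne_zero.2 (sub_ne_zero.2 hq.symm)) X_ne_zero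
  exact mul_left_cancel₀ h0 (h.trans h'.symm)

theorem one_add_C_mul_X_ne_zero [Nontrivial R] (a : R) : (1 + C a * X : R[X]) ≠ 0 := by
  intro h
  simpa using congrArg (fun p : R[X] => p.coeff 0) h

theorem desPoly_succ_right (t q : R) (d e : ℕ) :
    desPoly t q d (e + 1) = desPoly t q d e * (1 + C (t * q ^ (d + e + 1)) * X) := by
  rw [desPoly, desPoly, prod_range_succ, mul_assoc, show d + 1 + e = d + e + 1 by ring]

theorem desPoly_succ_left (t q : R) (d e : ℕ) :
    desPoly t q (d + 1) e * (1 + C (t * q ^ (d + 1)) * X) =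
      desPoly t q d e * (1 + C (q ^ (d + 1)) * X) * (1 + C (t * q ^ (d + e + 1)) * X) := by
  have h : (∏ i ∈ range e, (1 + C (t * q ^ (d + 1 + 1 + i)) * X)) *
      (1 + C (t * q ^ (d + 1)) * X : R[X]) =
      (∏ i ∈ range e, (1 + C (t * q ^ (d + 1 + i)) * X)) *
        (1 + C (t * q ^ (d + 1 + e)) * X) := by
    rw [← prod_range_succ (fun i => (1 + C (t * q ^ (d + 1 + i)) * X : R[X])), prod_range_succ']
    refine congrArg₂ (· * ·) (prod_congr rfl fun i _ => ?_) rfl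
    rw [show d + 1 + 1 + i = d + 1 + (i + 1) by ring]
  rw [desPoly, desPoly, prod_range_succ, show d + e + 1 = d + 1 + e by ring]
  linear_combination (∏ i ∈ range d, (1 + C (q ^ (i + 1)) * X)) *
    (1 + C (q ^ (d + 1)) * X : R[X]) * h

theorem desPoly_comp (t q : R) (d e : ℕ) :
    (desPoly t q d e).comp (C q * X) * (1 + C q * X) * (1 + C (t * q ^ (d + 1)) * X) =
      desPoly t q d e * (1 + C (q ^ (d + 1)) * X) * (1 + C (t * q ^ (d + e + 1)) * X) := by
  rw [← desPoly_succ_left, desPoly, desPoly, mul_comp, Polynomial.prod_comp, Polynomial.prod_comp,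
    prod_range_succ']
  have e1 : ∀ i, (1 + C (q ^ (i + 1)) * X : R[X]).comp (C q * X) =
      1 + C (q ^ (i + 1 + 1)) * X := fun i => by
    simp only [add_comp, one_comp, mul_comp, C_comp, X_comp, ← mul_assoc, ← C_mul, ← pow_succ]
  have e2 : ∀ i, (1 + C (t * q ^ (d + 1 + i)) * X : R[X]).comp (C q * X) =
      1 + C (t * q ^ (d + 1 + 1 + i)) * X := fun i => by
    simp only [add_comp, one_comp, mul_comp, C_comp, X_comp, ← mul_assoc, ← C_mul]
    congr 3; ring
  simp only [e1, e2, zero_add, pow_one]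
  ring

theorem stepRel_desPoly [IsDomain R] (t q : R) (d e : ℕ) :
    StepRel t q (d + e + 1) (desPoly t q d e)
      (C (∑ i ∈ range (d + 1), q ^ i) * desPoly t q d (e + 1) +
        C (t * q ^ (d + 1) * ∑ i ∈ range e, q ^ i) * desPoly t q (d + 1) e) := by
  have h1 := mul_neg_geom_sum q (d + 1)
  have h2 := mul_neg_geom_sum q e
  have h1 := congrArg (C : R → R[X]) h1
  have h2 := congrArg (C : R → R[X]) h2
  have h3 := desPoly_succ_left t q d e
  have h4 := desPoly_comp t q d e
  rw [StepRel, desPoly_succ_right]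
  refine mul_right_cancel₀ (one_add_C_mul_X_ne_zero (t * q ^ (d + 1))) ?_
  have e1 : q ^ (d + e + 1) = q ^ (d + 1) * q ^ e := by rw [← pow_add]; congr 1; ring
  rw [e1] at h3 h4 ⊢
  generalize desPoly t q d e = f at *
  generalize f.comp (C q * X) = f' at *
  generalize desPoly t q (d + 1) e = g at *
  generalize ∑ i ∈ range (d + 1), q ^ i = s1 at *
  generalize ∑ i ∈ range e, q ^ i = s2 at *
  generalize q ^ (d + 1) = Q at *
  generalize q ^ e = E at *
  simp only [map_mul, map_sub, map_one] at *
  linear_combination (X * f * (1 + C t * (C Q * C E) * X) * (1 + C t * C Q * X)) * h1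
    + X * C t * C Q * g * (1 + C t * C Q * X) * h2 + X * C t * C Q * (1 - C E) * h3
    + (1 + C t * (C Q * C E) * X) * h4

theorem sum_pow_card_filter_lt (q : R) (S : Finset ℕ) :
    ∑ x ∈ S, q ^ (S.filter (· < x)).card = ∑ i ∈ range S.card, q ^ i := by
  induction S using Finset.induction_on_max with
  | empty => simp
  | insert a s ha ih =>
    have has : a ∉ s := fun h => lt_irrefl _ (ha a h)
    rw [sum_insert has, card_insert_of_notMem has, sum_range_succ, ← ih, add_comm]
    congr 1
    · refine sum_congr rfl fun x hx => ?_
      rw [filter_insert, if_neg (not_lt.2 (ha x hx).le)]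
    · rw [filter_insert, if_neg (lt_irrefl a), filter_true_of_mem ha]

theorem sum_pow_card_filter_gt (q : R) (S : Finset ℕ) :
    ∑ x ∈ S, q ^ (S.filter (x < ·)).card = ∑ i ∈ range S.card, q ^ i := by
  induction S using Finset.induction_on_min with
  | empty => simp
  | insert a s ha ih =>
    have has : a ∉ s := fun h => lt_irrefl _ (ha a h)
    rw [sum_insert has, card_insert_of_notMem has, sum_range_succ, ← ih, add_comm]
    congr 1
    · refine sum_congr rfl fun x hx => ?_
      rw [filter_insert, if_neg (not_lt.2 (ha x hx).le)]
    · rw [filter_insert, if_neg (lt_irrefl a), filter_true_of_mem ha]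

/-- The polynomial relation for `X ^ h`. -/
theorem stepRel_X_pow (t q : R) (N h : ℕ) :
    StepRel t q N (X ^ h)
      (C (∑ i ∈ range (h + 1), q ^ i + (∑ i ∈ range h, q ^ i) * (t * q ^ N)) * X ^ h
        + C (t * q ^ N * ∑ i ∈ range (h + 1), q ^ i) * X ^ (h + 1)
        + C (∑ i ∈ range h, q ^ i) * X ^ (h - 1)) := by
  have h1 := congrArg (C : R → R[X]) (mul_neg_geom_sum q (h + 1))
  have h2 := congrArg (C : R → R[X]) (mul_neg_geom_sum q h)
  have h3 : C (∑ i ∈ range h, q ^ i) * X ^ (h - 1) * X =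
      (C (∑ i ∈ range h, q ^ i) * X ^ h : R[X]) := by
    cases h with
    | zero => simp
    | succ h => rw [Nat.add_sub_cancel, mul_assoc, ← pow_succ]
  rw [StepRel]
  simp only [pow_comp, X_comp, map_mul, map_sub, map_one, map_add, map_pow, mul_pow] at *
  linear_combination (X ^ (h + 1) + C t * C q ^ N * X ^ (h + 2)) * h1
    + (C t * C q ^ N * X ^ (h + 1) + X ^ h) * h2 + (1 - C q) * h3

end GeneratingFunctions

section MajorIndex

/-- Inserts the largest letter at the (0-based) position `k`. -/
def insertMax {n : ℕ} (k : Fin (n + 1)) (τ : Equiv.Perm (Fin n)) : Equiv.Perm (Fin (n + 1)) :=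
  (finSuccEquiv' k).trans ((Equiv.optionCongr τ).trans (finSuccEquiv' (Fin.last n)).symm)

theorem insertMax_self {n : ℕ} (k : Fin (n + 1)) (τ : Equiv.Perm (Fin n)) :
    insertMax k τ k = Fin.last n := by
  simp [insertMax]

theorem insertMax_succAbove {n : ℕ} (k : Fin (n + 1)) (τ : Equiv.Perm (Fin n)) (i : Fin n) :
    insertMax k τ (k.succAbove i) = (τ i).castSucc := by
  simp [insertMax]

theorem insertMax_bijective (n : ℕ) :
    Function.Bijective (fun x : Fin (n + 1) × Equiv.Perm (Fin n) => insertMax x.1 x.2) := by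
  rw [Fintype.bijective_iff_injective_and_card]
  refine ⟨?_, by simp [Fintype.card_perm, Nat.factorial_succ]⟩
  rintro ⟨k, τ⟩ ⟨k', τ'⟩ h
  simp only at h
  have hk : k = k' := by
    apply (insertMax k τ).injective
    rw [insertMax_self, h, insertMax_self]
  subst hk
  refine Prod.ext rfl (Equiv.ext fun i => ?_)
  have := insertMax_succAbove k τ i
  rw [h, insertMax_succAbove] at this
  exact (Fin.castSucc_injective n this).symm

theorem pval_le {n : ℕ} (π : Equiv.Perm (Fin n)) (i : ℕ) : pval π i ≤ n := by
  unfold pval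
  split <;> omega

theorem pval_of_fin {n : ℕ} (π : Equiv.Perm (Fin n)) (i : Fin n) :
    pval π (i + 1) = π i + 1 := by
  rw [pval, dif_pos ⟨by omega, by omega⟩]
  rfl

theorem pval_insertMax_lt {n : ℕ} (k : Fin (n + 1)) (τ : Equiv.Perm (Fin n)) {i : ℕ}
    (hi : i < k + 1) : pval (insertMax k τ) i = pval τ i := by
  rcases Nat.eq_zero_or_pos i with rfl | h0
  · simp [pval]
  · obtain ⟨j, rfl⟩ : ∃ j, i = j + 1 := ⟨i - 1, by omega⟩
    have hj : j < n := by omega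
    have h1 := pval_of_fin τ ⟨j, hj⟩
    have h2 := pval_of_fin (insertMax k τ) (Fin.castSucc ⟨j, hj⟩)
    have h3 := insertMax_succAbove k τ ⟨j, hj⟩
    rw [Fin.succAbove_of_castSucc_lt k _ (by rw [Fin.lt_def]; simp; omega)] at h3
    rw [h3] at h2
    simp only [Fin.val_castSucc] at h1 h2
    rw [h1, h2]

theorem pval_insertMax_self {n : ℕ} (k : Fin (n + 1)) (τ : Equiv.Perm (Fin n)) :
    pval (insertMax k τ) (k + 1) = n + 1 := by
  rw [pval_of_fin, insertMax_self, Fin.val_last]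

theorem pval_insertMax_gt {n : ℕ} (k : Fin (n + 1)) (τ : Equiv.Perm (Fin n)) {i : ℕ}
    (hi : k < i) (hn : i ≤ n) : pval (insertMax k τ) (i + 1) = pval τ i := by
  obtain ⟨j, rfl⟩ : ∃ j, i = j + 1 := ⟨i - 1, by omega⟩
  have hj : j < n := by omega
  have h1 := pval_of_fin τ ⟨j, hj⟩
  have h2 := pval_of_fin (insertMax k τ) (Fin.succ ⟨j, hj⟩)
  have h3 := insertMax_succAbove k τ ⟨j, hj⟩
  rw [Fin.succAbove_of_le_castSucc k _ (by rw [Fin.le_def]; simp; omega)] at h3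
  rw [h3] at h2
  simp only [Fin.val_castSucc, Fin.val_succ] at h1 h2
  rw [h1, h2]

theorem desSet_subset {n : ℕ} (τ : Equiv.Perm (Fin n)) : desSet τ ⊆ Ico 1 n := by
  intro i
  simp only [desSet, mem_filter, mem_Icc, mem_Ico]
  omega

/-- The descent set after inserting the largest letter at the 0-based position `k < n`. -/
theorem desSet_insertMax {n : ℕ} (k : Fin (n + 1)) (τ : Equiv.Perm (Fin n)) :
    desSet (insertMax k τ) =
      (desSet τ).filter (· < (k : ℕ)) ∪ (if (k : ℕ) < n then {(k : ℕ) + 1} else ∅) ∪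
        ((desSet τ).filter ((k : ℕ) < ·)).map ⟨(· + 1), add_left_injective 1⟩ := by
  have hk := pval_insertMax_self k τ
  ext i
  simp only [desSet, mem_union, mem_filter, mem_Icc, mem_map, Function.Embedding.coeFn_mk]
  have hlt : k.val < n + 1 := k.isLt
  have hI : i ∈ (if (k : ℕ) < n then {(k : ℕ) + 1} else ∅ : Finset ℕ) ↔
      k.val < n ∧ i = k.val + 1 := by
    split <;> simp [*]
  rw [hI]
  rcases lt_trichotomy i k with h | h | h
  · rw [pval_insertMax_lt k τ (show i < k + 1 by omega),
      pval_insertMax_lt k τ (show i + 1 < k + 1 by omega)]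
    constructor
    · intro h'; left; left; omega
    · rintro ((h' | h') | ⟨a, h'⟩) <;> omega
  · rw [h, hk]
    have := pval_le (insertMax k τ) k
    rw [pval_insertMax_lt k τ (show (k : ℕ) < k + 1 by omega)]
    have := pval_le τ k
    constructor
    · intro h'; omega
    · rintro ((h' | h') | ⟨a, h'⟩) <;> omega
  · obtain ⟨j, rfl⟩ : ∃ j, i = j + 1 := ⟨i - 1, by omega⟩
    rcases Nat.lt_or_ge n (j + 1) with hj | hj
    · constructor
      · intro h'; omega
      · rintro ((h' | h') | ⟨a, h'⟩) <;> omega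
    rw [pval_insertMax_gt k τ h hj]
    have := pval_le τ (j + 1)
    rcases eq_or_ne j k with hjk | hjk
    · rw [hjk, hk]
      rw [hjk] at this
      constructor
      · intro h'; left; right; omega
      · intro; omega
    · rw [pval_insertMax_gt k τ (show (k : ℕ) < j by omega) (by omega)]
      constructor
      · intro h'; right; exact ⟨j, by omega, rfl⟩
      · rintro ((h' | h') | ⟨a, h', h''⟩)
        · omega
        · omega
        · obtain rfl : a = j := by omega
          omega

theorem desStat_insertMax {n : ℕ} (k : Fin (n + 1)) (τ : Equiv.Perm (Fin n)) :
    desStat (insertMax k τ) = ((desSet τ).filter (· < (k : ℕ))).card +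
      (if (k : ℕ) < n then 1 else 0) + ((desSet τ).filter ((k : ℕ) < ·)).card := by
  rw [desStat, desSet_insertMax, card_union_of_disjoint, card_union_of_disjoint, card_map]
  · split <;> simp
  · split <;> simp
  · rw [disjoint_left]
    intro a
    split <;> simp <;> omega

theorem majStat_insertMax {n : ℕ} (k : Fin (n + 1)) (τ : Equiv.Perm (Fin n)) :
    majStat (insertMax k τ) = ∑ i ∈ (desSet τ).filter (· < (k : ℕ)), i +
      (if (k : ℕ) < n then (k : ℕ) + 1 else 0) +
      (∑ i ∈ (desSet τ).filter ((k : ℕ) < ·), i + ((desSet τ).filter ((k : ℕ) < ·)).card) := by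
  rw [majStat, desSet_insertMax, sum_union, sum_union, sum_map]
  · congr 1
    · split <;> simp
    · simp [sum_add_distrib]
  · split <;> simp
  · rw [disjoint_left]
    intro a
    split <;> simp <;> omega

variable {R : Type*} [CommRing R]

theorem sum_insertMax (q : R) (φ : ℕ → R) {n : ℕ} (τ : Equiv.Perm (Fin n)) :
    ∑ k : Fin (n + 1), φ (desStat (insertMax k τ)) * q ^ majStat (insertMax k τ) =
      q ^ majStat τ * ((∑ i ∈ range (desStat τ + 1), q ^ i) * φ (desStat τ) +
        q ^ (desStat τ + 1) * (∑ i ∈ range (n - desStat τ), q ^ i) * φ (desStat τ + 1)) := by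
  simp only [desStat_insertMax, majStat_insertMax]
  have hD := desSet_subset τ
  rw [majStat, desStat]
  generalize desSet τ = D at *
  have hDr : D ⊆ range n := fun i hi => by
    have := mem_Ico.1 (hD hi); exact mem_range.2 this.2
  rw [Fin.sum_univ_eq_sum_range (fun k => φ ((D.filter (· < k)).card +
      (if k < n then 1 else 0) + (D.filter (k < ·)).card) *
      q ^ (∑ i ∈ D.filter (· < k), i + (if k < n then k + 1 else 0) +
      (∑ i ∈ D.filter (k < ·), i + (D.filter (k < ·)).card))) (n + 1),
    sum_range_succ, ← sum_sdiff hDr]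
  have hlast1 : D.filter (· < n) = D :=
    filter_true_of_mem fun i hi => mem_range.1 (hDr hi)
  have hlast2 : D.filter (n < ·) = ∅ :=
    filter_false_of_mem fun i hi => by have := mem_range.1 (hDr hi); omega
  have hsplit : ∀ k, D = D.filter (· < k) ∪ (D.filter (· = k) ∪ D.filter (k < ·)) := by
    intro k
    ext i
    simp only [mem_union, mem_filter]
    have := lt_trichotomy i k
    tauto
  have hdis1 : ∀ k, Disjoint (D.filter (· < k)) (D.filter (· = k) ∪ D.filter (k < ·)) := by
    intro k; rw [disjoint_left]; intro i; simp only [mem_union, mem_filter]; omega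
  have hdis2 : ∀ k, Disjoint (D.filter (· = k)) (D.filter (k < ·)) := by
    intro k; rw [disjoint_left]; intro i; simp only [mem_filter]; omega
  have hcard : ∀ k, D.card = (D.filter (· < k)).card +
      ((D.filter (· = k)).card + (D.filter (k < ·)).card) := fun k => by
    conv_lhs => rw [hsplit k]
    rw [card_union_of_disjoint (hdis1 k), card_union_of_disjoint (hdis2 k)]
  have hsum : ∀ k, ∑ i ∈ D, i = ∑ i ∈ D.filter (· < k), i +
      (∑ i ∈ D.filter (· = k), i + ∑ i ∈ D.filter (k < ·), i) := fun k => by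
    conv_lhs => rw [hsplit k]
    rw [sum_union (hdis1 k), sum_union (hdis2 k)]
  have hA : ∀ k ∈ D, φ ((D.filter (· < k)).card +
      (if k < n then 1 else 0) + (D.filter (k < ·)).card) *
      q ^ (∑ i ∈ D.filter (· < k), i + (if k < n then k + 1 else 0) +
      (∑ i ∈ D.filter (k < ·), i + (D.filter (k < ·)).card)) =
      φ D.card * q ^ (∑ i ∈ D, i) * q * q ^ (D.filter (k < ·)).card := by
    intro k hk
    have hkn : k < n := mem_range.1 (hDr hk)
    have he : D.filter (· = k) = {k} := by ext i; simp only [mem_filter, mem_singleton]; grind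
    have h1 := hcard k
    have h2 := hsum k
    rw [he, card_singleton] at h1
    rw [he, sum_singleton] at h2
    rw [if_pos hkn, if_pos hkn, mul_assoc, mul_assoc, ← pow_succ', ← pow_add, h2]
    congr 2
    · omega
    · ring
  have hB : ∀ k ∈ range n \ D, φ ((D.filter (· < k)).card +
      (if k < n then 1 else 0) + (D.filter (k < ·)).card) *
      q ^ (∑ i ∈ D.filter (· < k), i + (if k < n then k + 1 else 0) +
      (∑ i ∈ D.filter (k < ·), i + (D.filter (k < ·)).card)) =
      φ (D.card + 1) * q ^ (∑ i ∈ D, i) * q ^ (D.card + 1) *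
        q ^ ((range n \ D).filter (· < k)).card := by
    intro k hk
    rw [mem_sdiff, mem_range] at hk
    obtain ⟨hkn, hk⟩ := hk
    have he : D.filter (· = k) = ∅ := by
      refine filter_false_of_mem fun i hi h => hk (h ▸ hi)
    have h1 := hcard k
    have h2 := hsum k
    rw [he, card_empty] at h1
    rw [he, sum_empty] at h2
    have h3 : ((range n \ D).filter (· < k)).card + (D.filter (· < k)).card = k := by
      rw [← card_union_of_disjoint]
      · conv_rhs => rw [← card_range k]
        congr 1
        ext i
        simp only [mem_union, mem_filter, mem_sdiff, mem_range]
        by_cases hi : i ∈ D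
        · simp [hi]
        · simp only [hi, not_false_eq_true, and_true, false_and, or_false]
          omega
      · rw [disjoint_left]; intro i; simp only [mem_filter, mem_sdiff]; tauto
    rw [if_pos hkn, if_pos hkn, mul_assoc, mul_assoc, ← pow_add, ← pow_add, h2]
    congr 2 <;> omega
  rw [sum_congr rfl hA, sum_congr rfl hB, ← mul_sum, ← mul_sum, sum_pow_card_filter_lt,
    sum_pow_card_filter_gt, card_sdiff_of_subset hDr, card_range, hlast1, hlast2, sum_range_succ']
  simp only [lt_irrefl, if_false, card_empty, sum_empty, add_zero, pow_succ, ← sum_mul, pow_zero]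
  ring

theorem sum_perm_succ (q : R) (φ : ℕ → R) (n : ℕ) :
    ∑ σ : Equiv.Perm (Fin (n + 1)), φ (desStat σ) * q ^ majStat σ =
      ∑ τ : Equiv.Perm (Fin n),
      q ^ majStat τ * ((∑ i ∈ range (desStat τ + 1), q ^ i) * φ (desStat τ) +
        q ^ (desStat τ + 1) * (∑ i ∈ range (n - desStat τ), q ^ i) * φ (desStat τ + 1)) := by
  rw [← (Equiv.ofBijective _ (insertMax_bijective n)).sum_comp, Fintype.sum_prod_type_right]
  exact sum_congr rfl fun τ _ => sum_insertMax q φ τ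

theorem desStat_le {n : ℕ} (τ : Equiv.Perm (Fin n)) : desStat τ ≤ n := by
  have := card_le_card (desSet_subset τ)
  rw [Nat.card_Ico] at this
  rw [desStat]
  omega

end MajorIndex

section MajPoly

open Polynomial

variable {R : Type*} [CommRing R]

/-- The refined generating polynomial of `(des, maj)` over `S_n`. -/
noncomputable def majPoly (t q : R) (n : ℕ) : R[X] :=
  ∑ σ : Equiv.Perm (Fin n),
    C (t ^ desStat σ * q ^ majStat σ) * desPoly t q (desStat σ) (n - desStat σ)

theorem stepRel_majPoly [IsDomain R] (t q : R) (n : ℕ) :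
    StepRel t q (n + 1) (majPoly t q n) (majPoly t q (n + 1)) := by
  have h := sum_perm_succ (C q) (fun d => C t ^ d * desPoly t q d (n + 1 - d)) n
  have h2 : majPoly t q (n + 1) = ∑ σ : Equiv.Perm (Fin n), C (t ^ desStat σ * q ^ majStat σ) *
      (C (∑ i ∈ range (desStat σ + 1), q ^ i) * desPoly t q (desStat σ) (n - desStat σ + 1) +
        C (t * q ^ (desStat σ + 1) * ∑ i ∈ range (n - desStat σ), q ^ i) *
          desPoly t q (desStat σ + 1) (n - desStat σ)) := by
    rw [majPoly]
    refine Eq.trans (sum_congr rfl fun σ _ => ?_) (h.trans (sum_congr rfl fun τ _ => ?_))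
    · simp only [C_mul, C_pow]; ring
    · have := desStat_le τ
      rw [show n + 1 - desStat τ = n - desStat τ + 1 by omega, Nat.add_sub_add_right]
      simp only [C_mul, C_pow, map_sum]
      ring
  rw [h2]
  refine StepRel.sum _ _ fun τ _ => ?_
  have := stepRel_desPoly t q (desStat τ) (n - desStat τ)
  rwa [Nat.add_sub_cancel' (desStat_le τ)] at this

theorem majPoly_zero (t q : R) : majPoly t q 0 = 1 := by
  have h : ∀ σ : Equiv.Perm (Fin 0), desSet σ = ∅ := fun σ =>
    subset_empty.1 (by simpa using desSet_subset σ)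
  simp [majPoly, desStat, majStat, h, desPoly]

theorem eval_zero_majPoly (t q : R) (n : ℕ) :
    (majPoly t q n).eval 0 = ∑ σ : Equiv.Perm (Fin n), t ^ desStat σ * q ^ majStat σ := by
  simp [majPoly, desPoly, eval_finsetSum, eval_prod]

end MajPoly

section Rooks

/-- Placements of non-attacking rooks on the board `[a] × [b]`, as sets of cells. -/
def rookPlacements (a b : ℕ) : Finset (Finset (ℕ × ℕ)) :=
  ((Icc 1 a ×ˢ Icc 1 b).powerset).filter
    (fun S => ∀ r ∈ S, ∀ s ∈ S, (r.1 = s.1 ∨ r.2 = s.2) → r = s)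

theorem mem_rookPlacements {a b : ℕ} {S : Finset (ℕ × ℕ)} :
    S ∈ rookPlacements a b ↔ (∀ r ∈ S, 1 ≤ r.1 ∧ r.1 ≤ a ∧ 1 ≤ r.2 ∧ r.2 ≤ b) ∧
      ∀ r ∈ S, ∀ s ∈ S, (r.1 = s.1 ∨ r.2 = s.2) → r = s := by
  simp only [rookPlacements, mem_filter, mem_powerset, subset_iff, mem_product, mem_Icc, and_assoc]

/-- The rows of `[a]` without a rook. -/
def openRows (a : ℕ) (S : Finset (ℕ × ℕ)) : Finset ℕ :=
  (Icc 1 a).filter (fun i => ∀ r ∈ S, r.1 ≠ i)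

/-- The columns of `[b]` without a rook. -/
def openCols (b : ℕ) (S : Finset (ℕ × ℕ)) : Finset ℕ :=
  (Icc 1 b).filter (fun j => ∀ r ∈ S, r.2 ≠ j)

theorem card_openRows {a b : ℕ} {S : Finset (ℕ × ℕ)} (hS : S ∈ rookPlacements a b) :
    (openRows a S).card = a - S.card := by
  rw [mem_rookPlacements] at hS
  have h1 : openRows a S = Icc 1 a \ S.image Prod.fst := by
    ext i; simp only [openRows, mem_filter, mem_sdiff, mem_image]; grind
  rw [h1, card_sdiff_of_subset, card_image_of_injOn, Nat.card_Icc, Nat.add_sub_cancel]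
  · intro r hr s hs h
    exact hS.2 r hr s hs (Or.inl h)
  · intro i hi
    simp only [mem_image] at hi
    obtain ⟨r, hr, rfl⟩ := hi
    have := hS.1 r hr
    exact mem_Icc.2 ⟨this.1, this.2.1⟩

theorem card_openCols {a b : ℕ} {S : Finset (ℕ × ℕ)} (hS : S ∈ rookPlacements a b) :
    (openCols b S).card = b - S.card := by
  rw [mem_rookPlacements] at hS
  have h1 : openCols b S = Icc 1 b \ S.image Prod.snd := by
    ext i; simp only [openCols, mem_filter, mem_sdiff, mem_image]; grind
  rw [h1, card_sdiff_of_subset, card_image_of_injOn, Nat.card_Icc, Nat.add_sub_cancel]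
  · intro r hr s hs h
    exact hS.2 r hr s hs (Or.inr h)
  · intro i hi
    simp only [mem_image] at hi
    obtain ⟨r, hr, rfl⟩ := hi
    have := hS.1 r hr
    exact mem_Icc.2 ⟨this.2.2.1, this.2.2.2⟩

theorem sum_rookPlacements_succ_right {M : Type*} [AddCommMonoid M] (a b : ℕ)
    (G : Finset (ℕ × ℕ) → M) :
    ∑ S ∈ rookPlacements a (b + 1), G S =
      ∑ S ∈ rookPlacements a b, (G S + ∑ p ∈ openRows a S, G (insert (p, b + 1) S)) := by
  rw [sum_add_distrib,
    ← sum_filter_add_sum_filter_not (rookPlacements a (b + 1)) (fun S => ∀ r ∈ S, r.2 ≠ b + 1)]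
  congr 1
  · refine sum_congr ?_ fun _ _ => rfl
    ext S
    rw [mem_filter, mem_rookPlacements, mem_rookPlacements]
    constructor
    · rintro ⟨⟨h1, h2⟩, h3⟩
      refine ⟨fun r hr => ?_, h2⟩
      have := h1 r hr
      have := h3 r hr
      omega
    · rintro ⟨h1, h2⟩
      refine ⟨⟨fun r hr => ?_, h2⟩, fun r hr => ?_⟩ <;>
      · have := h1 r hr
        omega
  · rw [sum_sigma']
    symm
    refine sum_bij (fun x _ => insert (x.2, b + 1) x.1) ?_ ?_ ?_ (fun _ _ => rfl)
    · rintro ⟨S, p⟩ h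
      simp only [mem_sigma, openRows, mem_filter, mem_Icc] at h
      obtain ⟨hS, hp, ho⟩ := h
      rw [mem_rookPlacements] at hS
      rw [mem_filter, mem_rookPlacements]
      obtain ⟨h1, h2⟩ := hS
      refine ⟨⟨?_, ?_⟩, ?_⟩
      · intro r hr
        rcases mem_insert.1 hr with rfl | hr
        · simp; omega
        · have := h1 r hr; omega
      · intro r hr s hs hrs
        rcases mem_insert.1 hr with rfl | hr <;> rcases mem_insert.1 hs with rfl | hs
        · rfl
        · have := h1 s hs
          have := ho s hs
          simp only at hrs
          omega
        · have := h1 r hr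
          have := ho r hr
          simp only at hrs
          omega
        · exact h2 r hr s hs hrs
      · push Not
        exact ⟨_, mem_insert_self _ _, rfl⟩
    · rintro ⟨S, p⟩ h ⟨S', p'⟩ h' heq
      simp only [mem_sigma, openRows, mem_filter, mem_Icc, mem_rookPlacements] at h h' heq
      have hn : ∀ x, (x, b + 1) ∉ S := fun x hx => by have := h.1.1 _ hx; simp at this
      have hn' : ∀ x, (x, b + 1) ∉ S' := fun x hx => by have := h'.1.1 _ hx; simp at this
      have hp : p = p' := by
        have : (p, b + 1) ∈ insert (p', b + 1) S' := heq ▸ mem_insert_self _ _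
        rcases mem_insert.1 this with h | h
        · exact (Prod.ext_iff.1 h).1
        · exact absurd h (hn' p)
      subst hp
      have : S = S' := by
        rw [← erase_insert (hn p), ← erase_insert (hn' p), heq]
      rw [this]
    · intro S hS
      rw [mem_filter, mem_rookPlacements] at hS
      obtain ⟨⟨h1, h2⟩, h3⟩ := hS
      push Not at h3
      obtain ⟨⟨p, c⟩, hr, hc⟩ := h3
      simp only at hc
      subst hc
      refine ⟨⟨S.erase (p, b + 1), p⟩, ?_, insert_erase hr⟩
      simp only [mem_sigma, openRows, mem_filter, mem_Icc, mem_rookPlacements, mem_erase]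
      have hp := h1 _ hr
      simp only at hp
      refine ⟨⟨?_, fun r hr s hs => h2 r hr.2 s hs.2⟩, ⟨hp.1, hp.2.1⟩, ?_⟩
      · rintro r ⟨hne, hrS⟩
        have := h1 r hrS
        have h5 : r.2 ≠ b + 1 := fun h => hne (h2 r hrS _ hr (Or.inr h))
        omega
      · rintro r ⟨hne, hrS⟩ h
        exact hne (h2 r hrS _ hr (Or.inl h))

theorem sum_rookPlacements_succ_left {M : Type*} [AddCommMonoid M] (a b : ℕ)
    (G : Finset (ℕ × ℕ) → M) :
    ∑ S ∈ rookPlacements (a + 1) b, G S =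
      ∑ S ∈ rookPlacements a b, (G S + ∑ v ∈ openCols b S, G (insert (a + 1, v) S)) := by
  let e : Finset (ℕ × ℕ) ≃ Finset (ℕ × ℕ) := (Equiv.prodComm ℕ ℕ).finsetCongr
  have he : ∀ S r, r ∈ e S ↔ r.swap ∈ S := by
    intro S r; simp [e, mem_map_equiv]
  have hmem : ∀ a b S, S ∈ rookPlacements a b ↔ e S ∈ rookPlacements b a := by
    intro a b S
    simp only [mem_rookPlacements, he, Prod.forall, Prod.swap_prod_mk, Prod.mk.injEq]
    grind
  have hop : ∀ S, openCols b S = openRows b (e S) := by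
    intro S
    ext j
    simp only [openCols, openRows, mem_filter, he, Prod.forall, Prod.swap_prod_mk]
    grind
  have hins : ∀ S v, e (insert (a + 1, v) S) = insert (v, a + 1) (e S) := by
    intro S v
    ext ⟨x, y⟩
    simp only [he, mem_insert, Prod.swap_prod_mk, Prod.mk.injEq]
    grind
  have h := sum_rookPlacements_succ_right b a (fun S => G (e.symm S))
  rw [sum_equiv e (hmem _ _) (g := fun S => G (e.symm S)) (by simp), h]
  symm
  refine sum_equiv e (hmem _ _) fun S _ => ?_
  rw [Equiv.symm_apply_apply, hop]
  congr 1
  refine sum_congr rfl fun v _ => ?_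
  rw [← hins, Equiv.symm_apply_apply]

/-- The places among `[a]` without a rook on or below the diagonal. -/
def excRows (a : ℕ) (S : Finset (ℕ × ℕ)) : Finset ℕ :=
  (Icc 1 a).filter (fun i => ∀ r ∈ S, r.1 = i → i < r.2)

/-- The contribution of the rook `r` to the Denert statistic of `S`. -/
def rookWeight (S : Finset (ℕ × ℕ)) (r : ℕ × ℕ) : ℕ :=
  if r.1 < r.2 then ((Ico 1 r.1).filter (fun i => ∀ s ∈ S, s.1 = i → r.2 < s.2)).card
  else ((Ico 1 r.2).filter (fun j => ∀ s ∈ S, s.2 = j → r.1 < s.1)).card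

theorem excRows_insert_right (n p : ℕ) (S : Finset (ℕ × ℕ)) :
    excRows n (insert (p, n + 1) S) = excRows n S := by
  ext i
  simp only [excRows, mem_filter, mem_Icc, forall_mem_insert]
  grind

theorem excRows_succ {n b : ℕ} {S : Finset (ℕ × ℕ)} (hS : S ∈ rookPlacements n b) :
    excRows (n + 1) S = insert (n + 1) (excRows n S) := by
  rw [mem_rookPlacements] at hS
  ext i
  simp only [excRows, mem_filter, mem_Icc, mem_insert]
  constructor
  · rintro ⟨h1, h2⟩
    by_cases h : i = n + 1
    · exact Or.inl h
    · exact Or.inr ⟨by omega, h2⟩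
  · rintro (rfl | ⟨h1, h2⟩)
    · refine ⟨by omega, fun r hr h => ?_⟩
      have := hS.1 r hr
      omega
    · exact ⟨by omega, h2⟩

theorem excRows_insert_left {n v : ℕ} (S : Finset (ℕ × ℕ)) (hv : v ≤ n + 1) :
    excRows (n + 1) (insert (n + 1, v) S) = excRows n S := by
  ext i
  simp only [excRows, mem_filter, mem_Icc, forall_mem_insert]
  constructor
  · rintro ⟨h1, h2, h3⟩
    refine ⟨⟨h1.1, ?_⟩, h3⟩
    by_contra h
    have := h2 (by omega)
    omega
  · rintro ⟨h1, h2⟩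
    exact ⟨⟨h1.1, by omega⟩, fun h => by omega, h2⟩

theorem sum_rookWeight_insert_right {n p : ℕ} {S : Finset (ℕ × ℕ)}
    (hS : S ∈ rookPlacements n n) (hp : p ∈ openRows n S) :
    ∑ r ∈ insert (p, n + 1) S, rookWeight (insert (p, n + 1) S) r =
      ∑ r ∈ S, rookWeight S r + ((openRows n S).filter (· < p)).card := by
  rw [mem_rookPlacements] at hS
  simp only [openRows, mem_filter, mem_Icc] at hp
  have hn : (p, n + 1) ∉ S := fun h => hp.2 _ h rfl
  rw [sum_insert hn, add_comm]
  congr 1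
  · refine sum_congr rfl fun r hr => ?_
    have := hS.1 r hr
    simp only [rookWeight, forall_mem_insert]
    congr 2 <;> ext i <;> simp only [mem_filter, mem_Ico] <;> grind
  · rw [rookWeight, if_pos (by simp only; omega)]
    congr 1
    ext i
    simp only [openRows, mem_filter, mem_Ico, mem_Icc, forall_mem_insert]
    constructor
    · rintro ⟨h1, -, h2⟩
      refine ⟨⟨by omega, fun r hr h => ?_⟩, h1.2⟩
      have := h2 r hr h
      have := hS.1 r hr
      omega
    · rintro ⟨⟨h1, h2⟩, h3⟩
      exact ⟨by omega, fun h => by omega, fun r hr h => absurd h (h2 r hr)⟩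

theorem sum_rookWeight_insert_left {n v : ℕ} {S : Finset (ℕ × ℕ)}
    (hS : S ∈ rookPlacements n (n + 1)) (hv : v ∈ openCols (n + 1) S) :
    ∑ r ∈ insert (n + 1, v) S, rookWeight (insert (n + 1, v) S) r =
      ∑ r ∈ S, rookWeight S r + ((openCols (n + 1) S).filter (· < v)).card := by
  rw [mem_rookPlacements] at hS
  simp only [openCols, mem_filter, mem_Icc] at hv
  have hn : (n + 1, v) ∉ S := fun h => hv.2 _ h rfl
  rw [sum_insert hn, add_comm]
  congr 1
  · refine sum_congr rfl fun r hr => ?_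
    have := hS.1 r hr
    simp only [rookWeight, forall_mem_insert]
    congr 2 <;> ext i <;> simp only [mem_filter, mem_Ico] <;> grind
  · rw [rookWeight, if_neg (by simp only; omega)]
    congr 1
    ext i
    simp only [openCols, mem_filter, mem_Ico, mem_Icc, forall_mem_insert]
    constructor
    · rintro ⟨h1, -, h2⟩
      refine ⟨⟨by omega, fun r hr h => ?_⟩, h1.2⟩
      have := h2 r hr h
      have := hS.1 r hr
      omega
    · rintro ⟨⟨h1, h2⟩, h3⟩
      exact ⟨by omega, fun h => by omega, fun r hr h => absurd h (h2 r hr)⟩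

variable {R : Type*} [CommRing R]

/-- The monomial attached to a rook placement on `[n] × [b]`, which specializes to
`t ^ exc * q ^ den` on permutation graphs. -/
def rookMonomial (t q : R) (n : ℕ) (S : Finset (ℕ × ℕ)) : R :=
  t ^ (excRows n S).card * q ^ (∑ i ∈ excRows n S, i + ∑ r ∈ S, rookWeight S r)

theorem card_insert_right {n p : ℕ} {S : Finset (ℕ × ℕ)} (hp : p ∈ openRows n S) (c : ℕ) :
    (insert (p, c) S).card = S.card + 1 :=
  card_insert_of_notMem fun h => (mem_filter.1 hp).2 _ h rfl

theorem card_insert_left {n v : ℕ} {S : Finset (ℕ × ℕ)} (hv : v ∈ openCols n S) (c : ℕ) :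
    (insert (c, v) S).card = S.card + 1 :=
  card_insert_of_notMem fun h => (mem_filter.1 hv).2 _ h rfl

theorem sum_rookMonomial_right (t q : R) (n : ℕ) (φ : ℕ → R) :
    ∑ S ∈ rookPlacements n (n + 1), rookMonomial t q n S * φ S.card =
      ∑ S ∈ rookPlacements n n, rookMonomial t q n S *
        (φ S.card + (∑ i ∈ range (n - S.card), q ^ i) * φ (S.card + 1)) := by
  rw [sum_rookPlacements_succ_right]
  refine sum_congr rfl fun S hS => ?_
  rw [mul_add, ← card_openRows hS, ← sum_pow_card_filter_lt, sum_mul, mul_sum]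
  congr 1
  refine sum_congr rfl fun p hp => ?_
  rw [card_insert_right hp, rookMonomial, excRows_insert_right n _ S,
    sum_rookWeight_insert_right hS hp, rookMonomial, ← add_assoc, pow_add q]
  ring

theorem sum_rookMonomial_left (t q : R) (n : ℕ) (φ : ℕ → R) :
    ∑ S ∈ rookPlacements (n + 1) (n + 1), rookMonomial t q (n + 1) S * φ S.card =
      ∑ S ∈ rookPlacements n (n + 1), rookMonomial t q n S *
        (t * q ^ (n + 1) * φ S.card +
          (∑ i ∈ range (n + 1 - S.card), q ^ i) * φ (S.card + 1)) := by
  rw [sum_rookPlacements_succ_left]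
  refine sum_congr rfl fun S hS => ?_
  rw [mul_add, ← card_openCols hS, ← sum_pow_card_filter_lt, sum_mul, mul_sum]
  congr 1
  · have hn : n + 1 ∉ excRows n S := fun h => by
      have := (mem_Icc.1 (mem_filter.1 h).1).2
      omega
    rw [rookMonomial, rookMonomial, excRows_succ hS, card_insert_of_notMem hn, sum_insert hn,
      pow_succ, add_assoc, pow_add q]
    ring
  · refine sum_congr rfl fun v hv => ?_
    have hv' := (mem_Icc.1 (mem_filter.1 hv).1).2
    rw [card_insert_left hv, rookMonomial, excRows_insert_left S hv',
      sum_rookWeight_insert_left hS hv, rookMonomial, ← add_assoc, pow_add q]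
    ring

theorem card_le_of_mem_rookPlacements {a b : ℕ} {S : Finset (ℕ × ℕ)}
    (hS : S ∈ rookPlacements a b) : S.card ≤ a := by
  rw [mem_rookPlacements] at hS
  rw [← card_image_of_injOn (f := Prod.fst) fun r hr s hs h => hS.2 r hr s hs (Or.inl h)]
  refine (card_le_card (t := Icc 1 a) ?_).trans (by simp)
  intro i hi
  simp only [mem_image] at hi
  obtain ⟨r, hr, rfl⟩ := hi
  have := hS.1 r hr
  exact mem_Icc.2 ⟨this.1, this.2.1⟩

end Rooks

section Denert

theorem winv_map_sort (S : Finset ℕ) (f : ℕ → ℕ) :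
    winv ((S.sort (· ≤ ·)).map f) =
      ((S ×ˢ S).filter (fun p => p.1 < p.2 ∧ f p.2 < f p.1)).card := by
  rw [winv]
  have hlt : ∀ i j (hi : i < (S.sort (· ≤ ·)).length) (hj : j < (S.sort (· ≤ ·)).length),
      i < j ↔ (S.sort (· ≤ ·))[i] < (S.sort (· ≤ ·))[j] := fun i j hi hj =>
    ((sortedLT_sort S).strictMono_get.lt_iff_lt (a := ⟨i, hi⟩) (b := ⟨j, hj⟩)).symm
  have hS : ∀ x, x ∈ S ↔ ∃ i, ∃ hi : i < (S.sort (· ≤ ·)).length, (S.sort (· ≤ ·))[i] = x := by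
    intro x
    rw [← mem_sort (· ≤ ·), List.mem_iff_getElem]
  generalize S.sort (· ≤ ·) = L at *
  refine card_bij (fun p _ => (L.getD p.1 0, L.getD p.2 0)) ?_ ?_ ?_
  · rintro ⟨i, j⟩ h
    simp only [mem_filter, mem_product, mem_range, List.length_map] at h ⊢
    obtain ⟨⟨hi, hj⟩, hij, hf⟩ := h
    simp only [List.getD_eq_getElem, List.length_map, hi, hj, List.getElem_map] at hf ⊢
    exact ⟨⟨(hS _).2 ⟨i, hi, rfl⟩, (hS _).2 ⟨j, hj, rfl⟩⟩, (hlt i j hi hj).1 hij, hf⟩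
  · rintro ⟨i, j⟩ h ⟨i', j'⟩ h' heq
    simp only [mem_filter, mem_product, mem_range, List.length_map] at h h'
    obtain ⟨⟨hi, hj⟩, -⟩ := h
    obtain ⟨⟨hi', hj'⟩, -⟩ := h'
    simp only [List.getD_eq_getElem, hi, hj, hi', hj', Prod.mk.injEq] at heq ⊢
    have h1 := hlt i i' hi hi'
    have h2 := hlt i' i hi' hi
    have h3 := hlt j j' hj hj'
    have h4 := hlt j' j hj' hj
    omega
  · rintro ⟨x, y⟩ h
    simp only [mem_filter, mem_product] at h
    obtain ⟨⟨hx, hy⟩, hxy, hf⟩ := h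
    obtain ⟨i, hi, rfl⟩ := (hS x).1 hx
    obtain ⟨j, hj, rfl⟩ := (hS y).1 hy
    refine ⟨(i, j), ?_, by simp [hi, hj]⟩
    simp only [mem_filter, mem_product, mem_range, List.length_map]
    simp only [List.getD_eq_getElem, List.length_map, hi, hj, List.getElem_map]
    exact ⟨⟨trivial, trivial⟩, (hlt i j hi hj).2 hxy, hf⟩

/-- The graph of a permutation, as a set of cells. -/
def permGraph {n : ℕ} (σ : Equiv.Perm (Fin n)) : Finset (ℕ × ℕ) :=
  (Icc 1 n).image (fun i => (i, pval σ i))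

theorem one_le_pval {n : ℕ} (σ : Equiv.Perm (Fin n)) {i : ℕ} (hi : i ∈ Icc 1 n) :
    1 ≤ pval σ i := by
  rw [pval, dif_pos (mem_Icc.1 hi)]
  omega

theorem pval_injOn {n : ℕ} (σ : Equiv.Perm (Fin n)) : Set.InjOn (pval σ) (Icc 1 n) := by
  intro i hi j hj h
  rw [mem_coe, mem_Icc] at hi hj
  rw [pval, dif_pos hi, pval, dif_pos hj, Nat.add_right_cancel_iff, Fin.val_inj,
    σ.apply_eq_iff_eq, Fin.mk.injEq] at h
  omega

theorem exists_pval_eq {n : ℕ} (σ : Equiv.Perm (Fin n)) {v : ℕ} (hv : v ∈ Icc 1 n) :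
    ∃ i ∈ Icc 1 n, pval σ i = v := by
  rw [mem_Icc] at hv
  refine ⟨σ.symm ⟨v - 1, by omega⟩ + 1, mem_Icc.2 ⟨by omega, by omega⟩, ?_⟩
  rw [pval_of_fin, σ.apply_symm_apply]
  exact Nat.sub_add_cancel hv.1

theorem card_permGraph {n : ℕ} (σ : Equiv.Perm (Fin n)) : (permGraph σ).card = n := by
  rw [permGraph, card_image_of_injective _ fun i j h => (Prod.ext_iff.1 h).1, Nat.card_Icc,
    Nat.add_sub_cancel]

theorem permGraph_mem {n : ℕ} (σ : Equiv.Perm (Fin n)) :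
    permGraph σ ∈ rookPlacements n n := by
  rw [mem_rookPlacements]
  simp only [permGraph, forall_mem_image]
  refine ⟨fun i hi => ?_, fun i hi j hj h => ?_⟩
  · have := mem_Icc.1 hi
    exact ⟨this.1, this.2, one_le_pval σ hi, pval_le σ i⟩
  · rcases h with h | h
    · obtain rfl : i = j := h
      rfl
    · obtain rfl : i = j := pval_injOn σ (mem_coe.2 hi) (mem_coe.2 hj) h
      rfl

theorem permGraph_injective (n : ℕ) :
    Function.Injective (permGraph : Equiv.Perm (Fin n) → Finset (ℕ × ℕ)) := by
  intro σ τ h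
  ext i
  have hi : (i : ℕ) + 1 ∈ Icc 1 n := mem_Icc.2 ⟨by omega, by omega⟩
  have : ((i : ℕ) + 1, pval σ (i + 1)) ∈ permGraph τ := h ▸ mem_image_of_mem _ hi
  simp only [permGraph, mem_image, Prod.mk.injEq] at this
  obtain ⟨j, hj, rfl, h2⟩ := this
  rw [pval_of_fin, pval_of_fin] at h2
  omega

theorem exists_permGraph_eq {n : ℕ} {S : Finset (ℕ × ℕ)} (hS : S ∈ rookPlacements n n)
    (hc : S.card = n) : ∃ σ : Equiv.Perm (Fin n), permGraph σ = S := by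
  have hcard := card_openRows hS
  rw [hc, Nat.sub_self, card_eq_zero, openRows, filter_eq_empty_iff] at hcard
  rw [mem_rookPlacements] at hS
  have hex : ∀ i : Fin n, ∃ j : Fin n, ((i : ℕ) + 1, (j : ℕ) + 1) ∈ S := by
    intro i
    have := hcard (x := (i : ℕ) + 1) (mem_Icc.2 ⟨by omega, by omega⟩)
    push Not at this
    obtain ⟨⟨a, b⟩, hr, hi⟩ := this
    simp only at hi
    have hb := hS.1 _ hr
    simp only at hb
    refine ⟨⟨b - 1, by omega⟩, ?_⟩
    rwa [Nat.sub_add_cancel hb.2.2.1, ← hi]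
  choose f hf using hex
  have hinj : Function.Injective f := by
    intro i j h
    have := hS.2 _ (hf i) _ (hf j) (Or.inr (by rw [h]))
    have := (Prod.ext_iff.1 this).1
    simp only at this
    omega
  refine ⟨Equiv.ofBijective f (Finite.injective_iff_bijective.1 hinj), ?_⟩
  refine eq_of_subset_of_card_le (fun r hr => ?_) (by rw [card_permGraph, hc])
  obtain ⟨i, hi, rfl⟩ := mem_image.1 hr
  obtain ⟨j, rfl⟩ : ∃ j : Fin n, (j : ℕ) + 1 = i := by
    rw [mem_Icc] at hi
    exact ⟨⟨i - 1, by omega⟩, Nat.sub_add_cancel hi.1⟩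
  rw [pval_of_fin]
  exact hf j

theorem excRows_permGraph {n : ℕ} (σ : Equiv.Perm (Fin n)) :
    excRows n (permGraph σ) = excpSet' σ := by
  ext i
  simp only [excRows, excpSet', mem_filter, permGraph, forall_mem_image]
  refine and_congr_right fun hi => ⟨fun h => h hi rfl, ?_⟩
  rintro h j - rfl
  exact h

theorem rookWeight_permGraph_of_lt {n : ℕ} (σ : Equiv.Perm (Fin n)) {i : ℕ} (hi : i ∈ Icc 1 n)
    (h : i < pval σ i) : rookWeight (permGraph σ) (i, pval σ i) =
      ((excpSet' σ).filter (fun j => j < i ∧ pval σ i < pval σ j)).card := by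
  rw [rookWeight, if_pos h]
  congr 1
  ext j
  rw [mem_filter, mem_filter, mem_Ico, excpSet', mem_filter, mem_Icc]
  rw [mem_Icc] at hi
  simp only [permGraph, forall_mem_image]
  constructor
  · rintro ⟨h1, h2⟩
    have := h2 (x := j) (mem_Icc.2 (by omega)) rfl
    omega
  · rintro ⟨h1, h2⟩
    refine ⟨by omega, ?_⟩
    rintro k - rfl
    exact h2.2

theorem rookWeight_permGraph_of_le {n : ℕ} (σ : Equiv.Perm (Fin n)) {i : ℕ} (h : pval σ i ≤ i) :
    rookWeight (permGraph σ) (i, pval σ i) =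
      ((Icc 1 n \ excpSet' σ).filter (fun j => i < j ∧ pval σ j < pval σ i)).card := by
  rw [rookWeight, if_neg (not_lt.2 h)]
  symm
  refine card_bij (fun j _ => pval σ j) ?_ ?_ ?_
  · intro j hj
    simp only [mem_filter, mem_sdiff] at hj
    rw [mem_filter, mem_Ico]
    refine ⟨⟨one_le_pval σ hj.1.1, hj.2.2⟩, ?_⟩
    simp only [permGraph, forall_mem_image]
    intro k hk hkj
    rw [pval_injOn σ (mem_coe.2 hk) (mem_coe.2 hj.1.1) hkj]
    exact hj.2.1
  · intro j hj k hk hjk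
    simp only [mem_filter, mem_sdiff] at hj hk
    exact pval_injOn σ (mem_coe.2 hj.1.1) (mem_coe.2 hk.1.1) hjk
  · intro v hv
    simp only [permGraph, forall_mem_image, mem_filter, mem_Ico] at hv
    have hle := pval_le σ i
    obtain ⟨j, hj, rfl⟩ := exists_pval_eq σ (v := v) (mem_Icc.2 ⟨by omega, by omega⟩)
    have hij := hv.2 hj rfl
    refine ⟨j, ?_, rfl⟩
    simp only [mem_filter, mem_sdiff, excpSet']
    exact ⟨⟨hj, fun h' => by omega⟩, hij, hv.1.2⟩

theorem sum_rookWeight_permGraph {n : ℕ} (σ : Equiv.Perm (Fin n)) :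
    ∑ r ∈ permGraph σ, rookWeight (permGraph σ) r = winv (excWord' σ) + winv (nexcWord' σ) := by
  have hsub : excpSet' σ ⊆ Icc 1 n := filter_subset _ _
  rw [excWord', nexcWord', winv_map_sort, winv_map_sort]
  have hN : ∀ i ∈ Icc 1 n \ excpSet' σ, rookWeight (permGraph σ) (i, pval σ i) =
      ((Icc 1 n \ excpSet' σ).filter (fun j => i < j ∧ pval σ j < pval σ i)).card :=
    fun i hi => rookWeight_permGraph_of_le σ (not_lt.1 fun h =>
      (mem_sdiff.1 hi).2 (mem_filter.2 ⟨(mem_sdiff.1 hi).1, h⟩))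
  have himage : ∑ r ∈ permGraph σ, rookWeight (permGraph σ) r =
      ∑ i ∈ Icc 1 n, rookWeight (permGraph σ) (i, pval σ i) :=
    sum_image fun i _ j _ h => (Prod.ext_iff.1 h).1
  rw [himage, ← sum_sdiff hsub, add_comm]
  congr 1
  · rw [sum_congr rfl fun i hi => rookWeight_permGraph_of_lt σ (hsub hi) (mem_filter.1 hi).2,
      card_filter, sum_product_right]
    exact sum_congr rfl fun i _ => card_filter _ _
  · rw [sum_congr rfl hN, card_filter, sum_product]
    exact sum_congr rfl fun i _ => card_filter _ _

variable {R : Type*} [CommRing R]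

theorem rookMonomial_permGraph (t q : R) {n : ℕ} (σ : Equiv.Perm (Fin n)) :
    rookMonomial t q n (permGraph σ) = t ^ excStat σ * q ^ denStat σ := by
  rw [rookMonomial, excRows_permGraph, sum_rookWeight_permGraph, excStat, denStat, add_assoc]

open Polynomial

/-- The refined generating polynomial of `(exc, den)`: partial permutations with `h` empty rows
contribute to the coefficient of `X ^ h`. -/
noncomputable def denPoly (t q : R) (n : ℕ) : R[X] :=
  ∑ S ∈ rookPlacements n n,
    C (rookMonomial t q n S * ∏ i ∈ range (n - S.card), ∑ j ∈ range (i + 1), q ^ j) *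
      X ^ (n - S.card)

theorem denPoly_zero (t q : R) : denPoly t q 0 = 1 := by
  have : rookPlacements 0 0 = {∅} := by decide
  simp [denPoly, this, rookMonomial, excRows]

theorem eval_zero_denPoly (t q : R) (n : ℕ) :
    (denPoly t q n).eval 0 = ∑ σ : Equiv.Perm (Fin n), t ^ excStat σ * q ^ denStat σ := by
  have h : (denPoly t q n).eval 0 =
      ∑ S ∈ (rookPlacements n n).filter (fun S => S.card = n), rookMonomial t q n S := by
    rw [denPoly, eval_finsetSum, sum_filter]
    refine sum_congr rfl fun S hS => ?_
    have := card_le_of_mem_rookPlacements hS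
    split_ifs with hc
    · simp [hc]
    · have : n - S.card ≠ 0 := by omega
      simp [this]
  rw [h]
  symm
  refine sum_bij (fun σ _ => permGraph σ) ?_ ?_ ?_ ?_
  · exact fun σ _ => mem_filter.2 ⟨permGraph_mem σ, card_permGraph σ⟩
  · exact fun σ _ τ _ h => permGraph_injective n h
  · intro S hS
    obtain ⟨σ, hσ⟩ := exists_permGraph_eq (mem_filter.1 hS).1 (mem_filter.1 hS).2
    exact ⟨σ, mem_univ _, hσ⟩
  · exact fun σ _ => (rookMonomial_permGraph t q σ).symm

theorem stepRel_denPoly (t q : R) (n : ℕ) :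
    StepRel t q (n + 1) (denPoly t q n) (denPoly t q (n + 1)) := by
  let ψ : ℕ → R[X] := fun h => C (∏ i ∈ range h, ∑ j ∈ range (i + 1), q ^ j) * X ^ h
  have hC : ∀ m S, rookMonomial (C t) (C q) m S = C (rookMonomial t q m S) := fun m S => by
    simp [rookMonomial]
  have hden : ∀ m, denPoly t q m =
      ∑ S ∈ rookPlacements m m, rookMonomial (C t) (C q) m S * ψ (m - S.card) := fun m =>
    sum_congr rfl fun S _ => by rw [hC, C_mul, mul_assoc]
  have h : denPoly t q (n + 1) = ∑ S ∈ rookPlacements n n,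
      C (rookMonomial t q n S * ∏ i ∈ range (n - S.card), ∑ j ∈ range (i + 1), q ^ j) *
      (C (∑ i ∈ range (n - S.card + 1), q ^ i +
          (∑ i ∈ range (n - S.card), q ^ i) * (t * q ^ (n + 1))) * X ^ (n - S.card)
        + C (t * q ^ (n + 1) * ∑ i ∈ range (n - S.card + 1), q ^ i) * X ^ (n - S.card + 1)
        + C (∑ i ∈ range (n - S.card), q ^ i) * X ^ (n - S.card - 1)) := by
    rw [hden, sum_rookMonomial_left (C t) (C q) n (fun c => ψ (n + 1 - c)),
      sum_rookMonomial_right (C t) (C q) n (fun c => C t * C q ^ (n + 1) * ψ (n + 1 - c) +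
        (∑ i ∈ range (n + 1 - c), C q ^ i) * ψ (n + 1 - (c + 1)))]
    refine sum_congr rfl fun S hS => ?_
    have hle := card_le_of_mem_rookPlacements hS
    rw [hC, C_mul, mul_assoc (C (rookMonomial t q n S))]
    refine congrArg (C (rookMonomial t q n S) * ·) ?_
    have e1 : n + 1 - S.card = n - S.card + 1 := by omega
    have e2 : n + 1 - (S.card + 1 + 1) = n - S.card - 1 := by omega
    rw [e1, e2, Nat.add_sub_add_right]
    generalize n - S.card = h
    cases h with
    | zero => simp [ψ]; ring
    | succ h =>
      simp only [ψ, Nat.add_sub_cancel, prod_range_succ _ (h + 1), prod_range_succ _ h, C_mul,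
        C_add, C_pow, map_sum]
      ring
  rw [h]
  exact StepRel.sum _ _ fun S _ => stepRel_X_pow t q (n + 1) (n - S.card)

theorem denPoly_eq_majPoly [IsDomain R] (t : R) {q : R} (hq : q ≠ 1) (n : ℕ) :
    denPoly t q n = majPoly t q n := by
  induction n with
  | zero => rw [denPoly_zero, majPoly_zero]
  | succ n ih => exact (stepRel_denPoly t q n).unique hq (ih ▸ stepRel_majPoly t q n)

theorem sum_des_maj_eq_sum_exc_den [IsDomain R] (t : R) {q : R} (hq : q ≠ 1) (n : ℕ) :
    ∑ σ : Equiv.Perm (Fin n), t ^ desStat σ * q ^ majStat σ =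
      ∑ σ : Equiv.Perm (Fin n), t ^ excStat σ * q ^ denStat σ := by
  rw [← eval_zero_majPoly, ← eval_zero_denPoly, denPoly_eq_majPoly t hq]

theorem coeff_coeff_sum_pow_mul_pow {ι : Type*} (s : Finset ι) (a b : ι → ℕ) (k m : ℕ) :
    ((∑ i ∈ s, (C X : ℤ[X][X]) ^ a i * X ^ b i).coeff m).coeff k =
      ((s.filter (fun i => a i = k ∧ b i = m)).card : ℤ) := by
  rw [finsetSum_coeff, finsetSum_coeff, card_filter, Nat.cast_sum]
  refine sum_congr rfl fun i _ => ?_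
  rw [← C_pow, coeff_C_mul, coeff_X_pow]
  by_cases h1 : m = b i <;> by_cases h2 : k = a i <;>
    simp [h1, h2, coeff_X_pow, eq_comm]

end Denert

/-- For all n ≥ 1, the pair (exc, den) is Euler-Mahonian over S_n:
for all k, m, the number of π ∈ S_n with des(π) = k and maj(π) = m equals the
number of π ∈ S_n with exc(π) = k and den(π) = m. -/
theorem eulerMahonian_exc_den (n : ℕ) (hn : 1 ≤ n) (k m : ℕ) :
    (Finset.univ.filter
      (fun π : Equiv.Perm (Fin n) => desStat π = k ∧ majStat π = m)).card =
    (Finset.univ.filter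
      (fun π : Equiv.Perm (Fin n) => excStat π = k ∧ denStat π = m)).card := by
  have hX : (Polynomial.X : Polynomial (Polynomial ℤ)) ≠ 1 := fun h => by
    simpa [Polynomial.coeff_one] using congrArg (fun p => Polynomial.coeff p 1) h
  have h := sum_des_maj_eq_sum_exc_den (R := Polynomial (Polynomial ℤ)) (Polynomial.C Polynomial.X)
    hX n
  have h' := congrArg (fun p => (p.coeff m).coeff k) h
  simp only [coeff_coeff_sum_pow_mul_pow] at h'
  exact_mod_cast h'
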